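/- Let k ≥ 1 and let C_{2k+1} be the odd cycle with vertices u_0, …, u_{2k} in cyclic order. For every i with 1 ≤ i ≤ k, the Sprague–Grundy value of the Closed Geodetic Game position on C_{2k+1} with u_0 and u_i already selected is 𝒢(C_{2k+1}, {u_0, u_i}) = k + 1 − i. -/

import Mathlib

open SimpleGraph

/-- mex: least nonnegative integer not in the set. -/
noncomputable def mex (X : Set ℕ) : ℕ := sInf Xᶜ

/-- The interval `I(u,v)`: vertices on some shortest `u`–`v` path. -/
def geodInterval {V : Type*} (G : SimpleGraph V) (u v : V) : Set V :=
  {w | G.dist u w + G.dist w v = G.dist u v}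

/-- The geodetic closure `(S)`. -/
def geodClosure {V : Type*} (G : SimpleGraph V) (S : Set V) : Set V :=
  ⋃ u ∈ S, ⋃ v ∈ S, geodInterval G u v

/-- Sprague–Grundy value of the Closed Geodetic Game on `G` with selected set `S`. -/
noncomputable def grundy {V : Type*} [Fintype V] [DecidableEq V]
    (G : SimpleGraph V) (S : Finset V) : ℕ :=
  mex (Set.range fun v : {v : V // v ∉ geodClosure G ↑S} =>
    grundy G (insert v.1 S))
termination_by Sᶜ.card
decreasing_by
  have hv : (v : V) ∉ S := by
    intro h
    exact v.2 (Set.mem_biUnion (by simpa using h)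
      (Set.mem_biUnion (by simpa using h) (by simp [geodInterval])))
  simp only [Finset.compl_insert]
  exact Finset.card_erase_lt_of_mem (by simpa using hv)

theorem mex_eq {X : Set ℕ} {m : ℕ} (hlt : ∀ x < m, x ∈ X) (hm : m ∉ X) : mex X = m :=
  (Nat.sInf_le hm).antisymm (le_csInf ⟨m, hm⟩ fun _ hx => not_lt.1 fun h => hx (hlt _ h))

theorem mem_geodClosure {V : Type*} {G : SimpleGraph V} {S : Set V} {w : V} :
    w ∈ geodClosure G S ↔ ∃ u ∈ S, ∃ v ∈ S, G.dist u w + G.dist w v = G.dist u v := by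
  simp [geodClosure, geodInterval]

theorem grundy_eq {V : Type*} [Fintype V] [DecidableEq V] {G : SimpleGraph V} {S : Finset V}
    {m : ℕ} (hlt : ∀ x < m, ∃ v ∉ geodClosure G (S : Set V), grundy G (insert v S) = x)
    (hm : ∀ v ∉ geodClosure G (S : Set V), grundy G (insert v S) ≠ m) : grundy G S = m := by
  rw [grundy]
  refine mex_eq (fun x hx => ?_) ?_
  · obtain ⟨v, hv, h⟩ := hlt x hx
    exact ⟨⟨v, hv⟩, h⟩
  · rintro ⟨v, h⟩
    exact hm v.1 v.2 h

theorem Fin.val_sub_eq_ite {n : ℕ} (x a : Fin n) :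
    (x - a).val = if a.val ≤ x.val then x.val - a.val else n + x.val - a.val := by
  split_ifs with h
  · exact Fin.coe_sub_iff_le.2 h
  · exact Fin.coe_sub_iff_lt.2 (not_le.1 h)

theorem cycleGraph_dist_le_sub {n : ℕ} (t p : ℕ) (h : p + t < n) :
    (cycleGraph n).dist ⟨p, by omega⟩ ⟨p + t, h⟩ ≤ t := by
  induction t with
  | zero => simp
  | succ t ih =>
    have hadj : (cycleGraph n).Adj ⟨p + t, by omega⟩ ⟨p + (t + 1), h⟩ := by
      rw [cycleGraph_adj']
      right
      rw [Fin.val_sub_eq_ite]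
      simp only
      split_ifs <;> omega
    have h1 := dist_eq_one_iff_adj.2 hadj
    have h2 := (cycleGraph_preconnected (⟨p, by omega⟩ : Fin n) ⟨p + t, by omega⟩).dist_triangle_left
      ⟨p + (t + 1), h⟩
    have h3 := ih (by omega)
    omega

theorem cycleGraph_dist_of_le {n : ℕ} {x y : Fin n} (h : x.val ≤ y.val) :
    (cycleGraph n).dist x y ≤ y.val - x.val := by
  have := cycleGraph_dist_le_sub (n := n) (y.val - x.val) x.val (by omega)
  simpa [Nat.add_sub_cancel' h] using this

theorem cycleGraph_dist_of_le' {n : ℕ} {x y : Fin n} (h : x.val < y.val) :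
    (cycleGraph n).dist x y ≤ n - (y.val - x.val) := by
  have hn : 0 < n := by omega
  set z : Fin n := ⟨0, hn⟩ with hz
  set l : Fin n := ⟨n - 1, by omega⟩ with hl
  have hadj : (cycleGraph n).Adj z l := by
    rw [cycleGraph_adj']
    left
    rw [Fin.val_sub_eq_ite]
    simp only [hz, hl]
    split_ifs <;> omega
  have h1 := dist_eq_one_iff_adj.2 hadj
  have h2 := cycleGraph_dist_of_le (x := z) (y := x) (by simp [hz])
  have h3 := cycleGraph_dist_of_le (x := y) (y := l) (by simp only [hl]; omega)
  rw [dist_comm] at h2 h3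
  have hc : (cycleGraph n).Preconnected := cycleGraph_preconnected
  have h4 := (hc x z).dist_triangle_left y
  have h5 := (hc z l).dist_triangle_left y
  simp only [hz, hl] at *
  omega

theorem Walk.le_length_cycleGraph {n : ℕ} {x y : Fin n} (p : (cycleGraph n).Walk x y) :
    min ((x.val - y.val) + (y.val - x.val)) (n - ((x.val - y.val) + (y.val - x.val)))
      ≤ p.length := by
  induction p with
  | nil => simp
  | cons h p ih =>
    rw [cycleGraph_adj', Fin.val_sub_eq_ite, Fin.val_sub_eq_ite] at h
    rw [Walk.length_cons]
    split_ifs at h <;> omega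

theorem cycleGraph_dist {n : ℕ} (x y : Fin n) :
    (cycleGraph n).dist x y =
      min ((x.val - y.val) + (y.val - x.val)) (n - ((x.val - y.val) + (y.val - x.val))) := by
  apply le_antisymm
  · rcases lt_trichotomy x.val y.val with h | h | h
    · have h1 := cycleGraph_dist_of_le h.le
      have h2 := cycleGraph_dist_of_le' h
      omega
    · simp [Fin.ext h]
    · have h1 := cycleGraph_dist_of_le h.le
      have h2 := cycleGraph_dist_of_le' h
      rw [dist_comm] at h1 h2
      omega
  · obtain ⟨p, hp⟩ := (cycleGraph_preconnected x y).exists_walk_length_eq_dist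
    exact hp ▸ Walk.le_length_cycleGraph p

/-- Distances in a cycle, computed from positions relative to a base vertex `a`. -/
theorem cycleGraph_dist_sub {n : ℕ} (a x y : Fin n) :
    (cycleGraph n).dist x y =
      min (((x - a).val - (y - a).val) + ((y - a).val - (x - a).val))
        (n - (((x - a).val - (y - a).val) + ((y - a).val - (x - a).val))) := by
  rw [cycleGraph_dist, Fin.val_sub_eq_ite, Fin.val_sub_eq_ite]
  split_ifs <;> omega

/-- The set `S` spans the arc of length `j` that starts at `a`: it contains both endpoints and
no vertex off the arc. -/
structure SpansArc {n : ℕ} (a : Fin n) (j : ℕ) (S : Finset (Fin n)) : Prop where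
  left_mem : a ∈ S
  right_mem : ∃ b ∈ S, (b - a).val = j
  val_le : ∀ x ∈ S, (x - a).val ≤ j

theorem Fin.val_sub_self_eq_zero {n : ℕ} (a : Fin n) : (a - a).val = 0 := by
  rw [Fin.val_sub_eq_ite]
  simp

theorem SpansArc.mem_geodClosure_iff {k j : ℕ} {a : Fin (2 * k + 1)}
    {S : Finset (Fin (2 * k + 1))} (h : SpansArc a j S) (hj : j ≤ k) (w : Fin (2 * k + 1)) :
    w ∈ geodClosure (cycleGraph (2 * k + 1)) (S : Set (Fin (2 * k + 1))) ↔ (w - a).val ≤ j := by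
  rw [mem_geodClosure]
  constructor
  · rintro ⟨u, hu, v, hv, e⟩
    have h1 := h.val_le u hu
    have h2 := h.val_le v hv
    have h3 := (w - a).isLt
    rw [cycleGraph_dist_sub a u w, cycleGraph_dist_sub a w v, cycleGraph_dist_sub a u v] at e
    omega
  · intro hw
    obtain ⟨b, hb, e⟩ := h.right_mem
    refine ⟨a, h.left_mem, b, hb, ?_⟩
    rw [cycleGraph_dist_sub a a w, cycleGraph_dist_sub a w b, cycleGraph_dist_sub a a b, e,
      Fin.val_sub_self_eq_zero]
    omega

theorem SpansArc.grundy_insert_eq_zero {k j : ℕ} {a v : Fin (2 * k + 1)}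
    {S : Finset (Fin (2 * k + 1))} (h : SpansArc a j S) (hj : j ≤ k)
    (hv : k < (v - a).val) (hv' : (v - a).val ≤ k + j) :
    grundy (cycleGraph (2 * k + 1)) (insert v S) = 0 := by
  refine grundy_eq (fun x hx => absurd hx (Nat.not_lt_zero x)) fun w hw => (hw ?_).elim
  rw [mem_geodClosure]
  obtain ⟨b, hb, e⟩ := h.right_mem
  have ha := Fin.val_sub_self_eq_zero a
  have hw' := (w - a).isLt
  have haS : a ∈ ((insert v S : Finset _) : Set (Fin (2 * k + 1))) := by simp [h.left_mem]
  have hbS : b ∈ ((insert v S : Finset _) : Set (Fin (2 * k + 1))) := by simp [hb]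
  have hvS : v ∈ ((insert v S : Finset _) : Set (Fin (2 * k + 1))) := by simp
  rcases le_total (w - a).val j with h1 | h1
  · refine ⟨a, haS, b, hbS, ?_⟩
    rw [cycleGraph_dist_sub a a w, cycleGraph_dist_sub a w b, cycleGraph_dist_sub a a b]
    omega
  rcases le_total (w - a).val (v - a).val with h2 | h2
  · refine ⟨b, hbS, v, hvS, ?_⟩
    rw [cycleGraph_dist_sub a b w, cycleGraph_dist_sub a w v, cycleGraph_dist_sub a b v]
    omega
  · refine ⟨v, hvS, a, haS, ?_⟩
    rw [cycleGraph_dist_sub a v w, cycleGraph_dist_sub a w a, cycleGraph_dist_sub a v a]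
    omega

theorem SpansArc.insert_right {n j : ℕ} {a v : Fin n} {S : Finset (Fin n)}
    (h : SpansArc a j S) (hv : j < (v - a).val) : SpansArc a (v - a).val (insert v S) where
  left_mem := Finset.mem_insert_of_mem h.left_mem
  right_mem := ⟨v, Finset.mem_insert_self _ _, rfl⟩
  val_le x hx := by
    rcases Finset.mem_insert.1 hx with rfl | hx
    · rfl
    · exact (h.val_le x hx).trans hv.le

theorem SpansArc.insert_left {n j : ℕ} {a v : Fin n} {S : Finset (Fin n)}
    (h : SpansArc a j S) (hv : j < (v - a).val) :
    SpansArc v (n - (v - a).val + j) (insert v S) where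
  left_mem := Finset.mem_insert_self _ _
  right_mem := by
    obtain ⟨b, hb, e⟩ := h.right_mem
    refine ⟨b, Finset.mem_insert_of_mem hb, ?_⟩
    rw [Fin.val_sub_eq_ite] at *
    rw [Fin.val_sub_eq_ite]
    split_ifs at * <;> omega
  val_le x hx := by
    rcases Finset.mem_insert.1 hx with rfl | hx
    · rw [Fin.val_sub_self_eq_zero]
      omega
    · have := h.val_le x hx
      rw [Fin.val_sub_eq_ite] at *
      rw [Fin.val_sub_eq_ite]
      split_ifs at * <;> omega

theorem Fin.exists_val_sub_eq {n : ℕ} (a : Fin n) {t : ℕ} (ht : t < n) :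
    ∃ v : Fin n, (v - a).val = t := by
  have : NeZero n := ⟨by omega⟩
  exact ⟨⟨t, ht⟩ + a, by simp⟩

theorem SpansArc.grundy_eq {k j : ℕ} {a : Fin (2 * k + 1)} {S : Finset (Fin (2 * k + 1))}
    (h : SpansArc a j S) (hj : 1 ≤ j) (hjk : j ≤ k) :
    grundy (cycleGraph (2 * k + 1)) S = k + 1 - j := by
  induction hm : k - j using Nat.strong_induction_on generalizing a j S with
  | _ m ih =>
    refine _root_.grundy_eq (fun x hx => ?_) fun v hv => ?_
    · rcases Nat.eq_zero_or_pos x with rfl | hx0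
      · obtain ⟨v, hv⟩ := Fin.exists_val_sub_eq a (t := k + 1) (by omega)
        exact ⟨v, by rw [h.mem_geodClosure_iff hjk]; omega,
          h.grundy_insert_eq_zero hjk (by omega) (by omega)⟩
      · obtain ⟨v, hv⟩ := Fin.exists_val_sub_eq a (t := k + 1 - x) (by omega)
        refine ⟨v, by rw [h.mem_geodClosure_iff hjk]; omega, ?_⟩
        rw [ih _ (by omega) (h.insert_right (v := v) (by omega)) (by omega) (by omega) rfl]
        omega
    · rw [h.mem_geodClosure_iff hjk, not_le] at hv
      have hv' := (v - a).isLt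
      rcases le_or_gt (v - a).val k with h1 | h1
      · rw [ih _ (by omega) (h.insert_right hv) (by omega) h1 rfl]
        omega
      rcases le_or_gt (v - a).val (k + j) with h2 | h2
      · rw [h.grundy_insert_eq_zero hjk h1 h2]
        omega
      · rw [ih _ (by omega) (h.insert_left hv) (by omega) (by omega) rfl]
        omega

/-- on the odd cycle `C_{2k+1}` (`k ≥ 1`), for `1 ≤ i ≤ k`, the Grundy
value of the Closed Geodetic Game position with `u_0` and `u_i` selected is `k+1-i`. -/
theorem grundy_odd_cycle_two_vertices (k : ℕ) (hk : 1 ≤ k) (i : ℕ)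
    (hi1 : 1 ≤ i) (hik : i ≤ k) :
    grundy (SimpleGraph.cycleGraph (2 * k + 1))
      ({(0 : Fin (2 * k + 1)), ⟨i, by omega⟩} : Finset (Fin (2 * k + 1))) = k + 1 - i := by
  refine SpansArc.grundy_eq (a := 0) ⟨by simp, ⟨⟨i, by omega⟩, by simp, by simp⟩, ?_⟩ hi1 hik
  intro x hx
  rcases Finset.mem_insert.1 hx with rfl | hx
  · simp
  · simp [Finset.mem_singleton.1 hx]
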